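/- arXiv:2210.06509 — 4 statements merged into one kernel-verified Lean document; each statement's English description precedes it below -/
import Mathlib

section
/- Let Ω be a metric space with Borel σ-algebra in which the distance between any two points is at most 1 (e.g., the unit cube with the supremum metric), and let μ and ν be Borel probability measures on Ω. Then the Wasserstein-1 distance is bounded by the H−W1 distance: ⨅ over couplings γ (probability measures on Ω × Ω whose first and second marginals are μ and ν respectively) of ∫ dist(x, x') dγ(x, x') ≤ d_{H−W1}(μ, ν). -/
open MeasureTheory

/-- The `H`–`W1` distance between two measures: the supremum of
`∫ h dμ − ∫ h dν` over measurable functions `h` with values in `[0,1]`. -/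
noncomputable def dHW1 {Ω : Type*} [MeasurableSpace Ω] (μ ν : Measure Ω) : ℝ :=
  sSup {r : ℝ | ∃ h : Ω → ℝ, Measurable h ∧ (∀ ω, 0 ≤ h ω) ∧ (∀ ω, h ω ≤ 1) ∧
    r = ∫ ω, h ω ∂μ - ∫ ω, h ω ∂ν}

/-- The diagonal coupling of the common part `m` of `m + α` and `m + β`, plus the normalised
product of the remainders. -/
noncomputable def commonPartCoupling {Ω : Type*} [MeasurableSpace Ω] (m α β : Measure Ω) :
    Measure (Ω × Ω) :=
  m.map (fun x => (x, x)) + (α Set.univ)⁻¹ • α.prod β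

lemma inv_smul_smul_measure_self {Ω : Type*} [MeasurableSpace Ω] (α : Measure Ω)
    [IsFiniteMeasure α] : (α Set.univ)⁻¹ • α Set.univ • α = α := by
  by_cases h : α = 0
  · simp [h]
  · rw [smul_smul, ENNReal.inv_mul_cancel (by simpa using h) (measure_ne_top _ _), one_smul]

lemma map_fst_commonPartCoupling {Ω : Type*} [MeasurableSpace Ω] (m α β : Measure Ω)
    [IsFiniteMeasure α] [IsFiniteMeasure β] (h : α Set.univ = β Set.univ) :
    (commonPartCoupling m α β).map Prod.fst = m + α := by
  have hd : Measurable fun x : Ω => (x, x) := measurable_id.prodMk measurable_id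
  rw [commonPartCoupling, Measure.map_add _ _ measurable_fst, Measure.map_map measurable_fst hd,
    Measure.map_smul, Measure.map_fst_prod, ← h, inv_smul_smul_measure_self]
  congr 1
  exact Measure.map_id

lemma map_snd_commonPartCoupling {Ω : Type*} [MeasurableSpace Ω] (m α β : Measure Ω)
    [IsFiniteMeasure α] [IsFiniteMeasure β] (h : α Set.univ = β Set.univ) :
    (commonPartCoupling m α β).map Prod.snd = m + β := by
  have hd : Measurable fun x : Ω => (x, x) := measurable_id.prodMk measurable_id
  rw [commonPartCoupling, Measure.map_add _ _ measurable_snd, Measure.map_map measurable_snd hd,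
    Measure.map_smul, Measure.map_snd_prod, h, inv_smul_smul_measure_self]
  congr 1
  exact Measure.map_id

/-- The product `σ`-algebra may fail to make `dist` measurable; the integral is then `0`. -/
lemma integral_dist_commonPartCoupling_le {Ω : Type*} [MeasurableSpace Ω] [PseudoMetricSpace Ω]
    (hdist : ∀ x y : Ω, dist x y ≤ 1) (m α β : Measure Ω)
    [IsFiniteMeasure α] [IsFiniteMeasure β] (h : α Set.univ = β Set.univ) :
    ∫ p, dist p.1 p.2 ∂(commonPartCoupling m α β) ≤ α.real Set.univ := by
  by_cases hi : Integrable (fun p : Ω × Ω => dist p.1 p.2) (commonPartCoupling m α β)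
  · have hd : Measurable fun x : Ω => (x, x) := measurable_id.prodMk measurable_id
    have hmass : ((α Set.univ)⁻¹ • α.prod β) Set.univ = α Set.univ := by
      have := congrArg (fun μ : Measure Ω => μ Set.univ) (inv_smul_smul_measure_self α)
      simpa [← Set.univ_prod_univ, Measure.prod_prod, ← h] using this
    have : IsFiniteMeasure ((α Set.univ)⁻¹ • α.prod β) := ⟨by rw [hmass]; exact measure_lt_top _ _⟩
    rw [commonPartCoupling] at hi ⊢
    rw [integral_add_measure hi.left_of_add_measure hi.right_of_add_measure,
      integral_map hd.aemeasurable hi.left_of_add_measure.aestronglyMeasurable]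
    have hle := norm_integral_le_of_norm_le_const (μ := (α Set.univ)⁻¹ • α.prod β)
      (f := fun p : Ω × Ω => dist p.1 p.2) (C := 1)
      (.of_forall fun p => by simpa [abs_of_nonneg dist_nonneg] using hdist p.1 p.2)
    rw [one_mul, measureReal_def, hmass] at hle
    simpa [measureReal_def] using (le_abs_self _).trans hle
  · rw [integral_undef hi]
    exact measureReal_nonneg

lemma measureReal_sub_le_dHW1 {Ω : Type*} [MeasurableSpace Ω] (μ ν : Measure Ω)
    [IsFiniteMeasure μ] [IsFiniteMeasure ν] {s : Set Ω} (hs : MeasurableSet s) :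
    μ.real s - ν.real s ≤ dHW1 μ ν := by
  refine le_csSup ⟨μ.real Set.univ, ?_⟩
    ⟨s.indicator 1, measurable_one.indicator hs, fun ω => ?_, fun ω => ?_, ?_⟩
  · rintro r ⟨h, -, h0, h1, rfl⟩
    have hμ := norm_integral_le_of_norm_le_const (μ := μ) (f := h) (C := 1)
      (.of_forall fun ω => by simpa [abs_of_nonneg (h0 ω)] using h1 ω)
    have hν : 0 ≤ ∫ ω, h ω ∂ν := integral_nonneg h0
    rw [one_mul] at hμ
    linarith [(le_abs_self _).trans hμ]
  · exact Set.indicator_nonneg (fun _ _ => zero_le_one) ω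
  · exact Set.indicator_le_self' (fun _ _ => zero_le_one) ω
  · rw [integral_indicator_one hs, integral_indicator_one hs]

/-- Two finite measures of equal mass decompose into a common part and remainders whose mass is
the excess of one measure over the other on some measurable set. -/
lemma exists_common_part {Ω : Type*} [MeasurableSpace Ω] (μ ν : Measure Ω)
    [IsFiniteMeasure μ] [IsFiniteMeasure ν] (h : μ Set.univ = ν Set.univ) :
    ∃ (m α β : Measure Ω) (s : Set Ω), IsFiniteMeasure α ∧ IsFiniteMeasure β ∧
      m + α = μ ∧ m + β = ν ∧ α Set.univ = β Set.univ ∧ MeasurableSet s ∧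
      α.real Set.univ = μ.real s - ν.real s := by
  obtain ⟨s, hs⟩ := exists_isHahnDecomposition ν μ
  have hms := hs.measurableSet
  have h1 : ν.restrict s ≤ μ.restrict s := hs.le_on
  have h2 : μ.restrict sᶜ ≤ ν.restrict sᶜ := hs.ge_on_compl
  have hμ : ν.restrict s + μ.restrict sᶜ + (μ.restrict s - ν.restrict s) = μ := by
    rw [add_right_comm, add_comm (ν.restrict s), Measure.sub_add_cancel_of_le h1,
      Measure.restrict_add_restrict_compl hms]
  have hν : ν.restrict s + μ.restrict sᶜ + (ν.restrict sᶜ - μ.restrict sᶜ) = ν := by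
    rw [add_assoc, add_comm (μ.restrict sᶜ), Measure.sub_add_cancel_of_le h2,
      Measure.restrict_add_restrict_compl hms]
  refine ⟨_, _, _, s, inferInstance, inferInstance, hμ, hν, ?_, hms, ?_⟩
  · exact (ENNReal.add_right_inj (measure_ne_top (ν.restrict s + μ.restrict sᶜ) Set.univ)).1
      ((congrArg (· Set.univ) hμ).trans (h.trans (congrArg (· Set.univ) hν).symm))
  · rw [measureReal_def, Measure.sub_apply .univ h1,
      ENNReal.toReal_sub_of_le (h1 _) (measure_ne_top _ _)]
    simp [measureReal_def]

/-- On a metric space whose diameter is at most `1`, the Wasserstein-1 distance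
(the infimum over couplings `γ` of `μ` and `ν` of `∫ dist(x, x') dγ`) is bounded
by the `H`–`W1` distance. -/
theorem wasserstein1_le_dHW1 {Ω : Type*} [MeasurableSpace Ω] [MetricSpace Ω] [BorelSpace Ω]
    (hdist : ∀ x y : Ω, dist x y ≤ 1)
    (μ ν : Measure Ω) [IsProbabilityMeasure μ] [IsProbabilityMeasure ν] :
    sInf {r : ℝ | ∃ γ : Measure (Ω × Ω), IsProbabilityMeasure γ ∧
        γ.map Prod.fst = μ ∧ γ.map Prod.snd = ν ∧ r = ∫ p, dist p.1 p.2 ∂γ}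
      ≤ dHW1 μ ν := by
  obtain ⟨m, α, β, s, _, _, hμ, hν, hαβ, hs, hmass⟩ := exists_common_part μ ν (by simp)
  have hfst := (map_fst_commonPartCoupling m α β hαβ).trans hμ
  have hsnd := (map_snd_commonPartCoupling m α β hαβ).trans hν
  have hprob : IsProbabilityMeasure (commonPartCoupling m α β) := by
    constructor
    rw [← Set.preimage_univ (f := Prod.fst), ← Measure.map_apply measurable_fst .univ, hfst,
      measure_univ]
  refine csInf_le_of_le ⟨0, ?_⟩ ⟨_, hprob, hfst, hsnd, rfl⟩
    ((integral_dist_commonPartCoupling_le hdist m α β hαβ).trans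
      (hmass.trans_le (measureReal_sub_le_dHW1 μ ν hs)))
  rintro r ⟨γ, -, -, -, rfl⟩
  exact integral_nonneg fun _ => dist_nonneg
end

section
/- (Theorem 1, computing backdoor distance) Let λ be a σ-finite measure on a measurable space Ω, let μ and ν be probability measures with measurable densities p and q with respect to λ, let S ⊆ Ω be measurable, and let Z ≥ 1 be a real number such that q(ω) = p(ω)/Z for λ-almost every ω ∈ Ω \ S. Then d_{H−W1}(μ, ν) = ∫_S max(q(ω) − p(ω), 0) dλ(ω). -/
open MeasureTheory

/-- A nonnegative density of a finite measure is integrable. -/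
theorem integrable_of_withDensity_ofReal {Ω : Type*} [MeasurableSpace Ω] {lam : Measure Ω}
    {f : Ω → ℝ} (hf : Measurable f) (hf0 : ∀ ω, 0 ≤ f ω)
    [IsFiniteMeasure (lam.withDensity fun ω => ENNReal.ofReal (f ω))] : Integrable f lam := by
  refine ⟨hf.aestronglyMeasurable, ?_⟩
  rw [hasFiniteIntegral_iff_ofReal (Filter.Eventually.of_forall hf0)]
  simpa [withDensity_apply] using
    measure_lt_top (lam.withDensity fun ω => ENNReal.ofReal (f ω)) Set.univ

/-- Integration against a measure with a nonnegative real density. -/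
theorem integral_withDensity_ofReal_eq {Ω : Type*} [MeasurableSpace Ω] {lam : Measure Ω}
    {f : Ω → ℝ} (hf : Measurable f) (hf0 : ∀ ω, 0 ≤ f ω) (h : Ω → ℝ) :
    ∫ ω, h ω ∂(lam.withDensity fun ω => ENNReal.ofReal (f ω)) = ∫ ω, f ω * h ω ∂lam := by
  rw [integral_withDensity_eq_integral_toReal_smul hf.ennreal_ofReal
    (Filter.Eventually.of_forall fun _ => ENNReal.ofReal_lt_top)]
  simp [ENNReal.toReal_ofReal, hf0]

/-- The `H`–`W1` distance between finite measures with densities `p` and `q` is the integral of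
the positive part of `p - q`. -/
theorem dHW1_withDensity_ofReal {Ω : Type*} [MeasurableSpace Ω] {lam : Measure Ω}
    {p q : Ω → ℝ} (hp : Measurable p) (hq : Measurable q)
    (hp0 : ∀ ω, 0 ≤ p ω) (hq0 : ∀ ω, 0 ≤ q ω)
    (hpi : Integrable p lam) (hqi : Integrable q lam) :
    dHW1 (lam.withDensity fun ω => ENNReal.ofReal (p ω))
      (lam.withDensity fun ω => ENNReal.ofReal (q ω)) = ∫ ω, max (p ω - q ω) 0 ∂lam := by
  have key : ∀ h : Ω → ℝ, Measurable h → (∀ ω, 0 ≤ h ω) → (∀ ω, h ω ≤ 1) →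
      Integrable (fun ω => (p ω - q ω) * h ω) lam ∧
      ∫ ω, h ω ∂(lam.withDensity fun ω => ENNReal.ofReal (p ω)) -
        ∫ ω, h ω ∂(lam.withDensity fun ω => ENNReal.ofReal (q ω)) =
        ∫ ω, (p ω - q ω) * h ω ∂lam := by
    intro h hm h0 h1
    have hb : ∀ᵐ ω ∂lam, ‖h ω‖ ≤ 1 := Filter.Eventually.of_forall fun ω => by
      rw [Real.norm_of_nonneg (h0 ω)]
      exact h1 ω
    have ip := hpi.mul_bdd hm.aestronglyMeasurable hb
    have iq := hqi.mul_bdd hm.aestronglyMeasurable hb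
    refine ⟨(hpi.sub hqi).mul_bdd hm.aestronglyMeasurable hb, ?_⟩
    rw [integral_withDensity_ofReal_eq hp hp0, integral_withDensity_ofReal_eq hq hq0,
      ← integral_sub ip iq]
    simp only [sub_mul]
  refine IsGreatest.csSup_eq ⟨?_, ?_⟩
  · have hm : Measurable ({ω | q ω ≤ p ω}.indicator fun _ => (1 : ℝ)) :=
      measurable_const.indicator (measurableSet_le hq hp)
    have h0 : ∀ ω, 0 ≤ {ω | q ω ≤ p ω}.indicator (fun _ => (1 : ℝ)) ω :=
      fun ω => Set.indicator_nonneg (fun _ _ => zero_le_one) ω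
    have h1 : ∀ ω, {ω | q ω ≤ p ω}.indicator (fun _ => (1 : ℝ)) ω ≤ 1 :=
      fun ω => Set.indicator_le' (fun _ _ => le_rfl) (fun _ _ => zero_le_one) ω
    refine ⟨_, hm, h0, h1, ?_⟩
    rw [(key _ hm h0 h1).2]
    refine integral_congr_ae (Filter.Eventually.of_forall fun ω => ?_)
    by_cases hω : q ω ≤ p ω
    · simp [hω]
    · simp [hω, (not_le.mp hω).le]
  · rintro r ⟨h, hm, h0, h1, rfl⟩
    obtain ⟨hi, he⟩ := key h hm h0 h1
    rw [he]
    refine integral_mono hi (hpi.sub hqi).pos_part fun ω => ?_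
    calc (p ω - q ω) * h ω ≤ max (p ω - q ω) 0 * h ω :=
          mul_le_mul_of_nonneg_right (le_max_left _ _) (h0 ω)
      _ ≤ max (p ω - q ω) 0 := mul_le_of_le_one_right (le_max_right _ _) (h1 ω)

/-- (Theorem 1, computing backdoor distance.) If `μ` (primary) and `ν` (backdoor) are
probability measures with densities `p` and `q` with respect to a σ-finite measure `lam`,
`S` is measurable, and `q = p / Z` λ-a.e. outside `S` for some `Z ≥ 1`, then
`d_{H−W1}(μ, ν) = ∫_S max(q − p, 0) dlam`. -/
theorem dHW1_eq_setIntegral_max {Ω : Type*} [MeasurableSpace Ω]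
    (lam : Measure Ω) [SigmaFinite lam]
    (p q : Ω → ℝ) (hp : Measurable p) (hq : Measurable q)
    (hp0 : ∀ ω, 0 ≤ p ω) (hq0 : ∀ ω, 0 ≤ q ω)
    (μ ν : Measure Ω) [IsProbabilityMeasure μ] [IsProbabilityMeasure ν]
    (hμ : μ = lam.withDensity fun ω => ENNReal.ofReal (p ω))
    (hν : ν = lam.withDensity fun ω => ENNReal.ofReal (q ω))
    (S : Set Ω) (hS : MeasurableSet S)
    (Z : ℝ) (hZ : 1 ≤ Z)
    (hoff : ∀ᵐ ω ∂lam, ω ∉ S → q ω = p ω / Z) :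
    dHW1 μ ν = ∫ ω in S, max (q ω - p ω) 0 ∂lam := by
  subst hμ hν
  have hpi := integrable_of_withDensity_ofReal (lam := lam) hp hp0
  have hqi := integrable_of_withDensity_ofReal (lam := lam) hq hq0
  have mass : ∀ f : Ω → ℝ, Measurable f → (∀ ω, 0 ≤ f ω) →
      IsProbabilityMeasure (lam.withDensity fun ω => ENNReal.ofReal (f ω)) →
      ∫ ω, f ω ∂lam = 1 := by
    intro f hf hf0 _
    simpa using (integral_withDensity_ofReal_eq (lam := lam) hf hf0 fun _ => 1).symm
  have hmass : ∫ ω, (p ω - q ω) ∂lam = 0 := by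
    rw [integral_sub hpi hqi, mass p hp hp0 inferInstance, mass q hq hq0 inferInstance, sub_self]
  have hoff0 : ∀ᵐ ω ∂lam, ω ∉ S → max (q ω - p ω) 0 = 0 := by
    filter_upwards [hoff] with ω hω hωS
    rw [hω hωS]
    exact max_eq_right (sub_nonpos.mpr (div_le_self (hp0 ω) hZ))
  have ipos : Integrable (fun ω => max (p ω - q ω) 0) lam := (hpi.sub hqi).pos_part
  have ineg : Integrable (fun ω => max (q ω - p ω) 0) lam := (hqi.sub hpi).pos_part
  rw [dHW1_withDensity_ofReal hp hq hp0 hq0 hpi hqi,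
    setIntegral_eq_integral_of_ae_compl_eq_zero hoff0, ← sub_eq_zero, ← integral_sub ipos ineg]
  refine Eq.trans ?_ hmass
  refine integral_congr_ae (Filter.Eventually.of_forall fun ω => ?_)
  rcases le_total (p ω) (q ω) with h | h <;> simp [h]
end

section
/- (Lemma 1) Let λ be a σ-finite measure on a measurable space Ω, let μ and ν be probability measures with measurable densities p and q with respect to λ, let S ⊆ Ω be measurable, and let Z ≥ 1 be a real number such that q(ω) = p(ω)/Z for λ-almost every ω ∈ Ω \ S. Suppose further that b, κ, β are positive reals with μ(S) = b/κ > 0 and ν(S) = β·b/Z > 0. Then d_{H−W1}(μ, ν) = b · ∫_S max( (β/Z)·q(ω)/ν(S) − (1/κ)·p(ω)/μ(S), 0 ) dλ(ω). -/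
open MeasureTheory

/-- A nonnegative density of a finite measure is integrable. -/
theorem integrable_of_isFiniteMeasure_withDensity_ofReal {Ω : Type*} [MeasurableSpace Ω]
    {lam : Measure Ω} {p : Ω → ℝ} (hp : Measurable p) (hp0 : ∀ ω, 0 ≤ p ω)
    (hfin : IsFiniteMeasure (lam.withDensity fun ω => ENNReal.ofReal (p ω))) :
    Integrable p lam := by
  refine (lintegral_ofReal_ne_top_iff_integrable hp.aestronglyMeasurable (.of_forall hp0)).mp ?_
  have h := measure_ne_top (lam.withDensity fun ω => ENNReal.ofReal (p ω)) Set.univ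
  rwa [withDensity_apply _ MeasurableSet.univ, setLIntegral_univ] at h

/-- Integration against a measure with a nonnegative real density. -/
theorem integral_withDensity_ofReal {Ω : Type*} [MeasurableSpace Ω]
    {lam : Measure Ω} {p : Ω → ℝ} (hp : Measurable p) (hp0 : ∀ ω, 0 ≤ p ω) (h : Ω → ℝ) :
    ∫ ω, h ω ∂(lam.withDensity fun ω => ENNReal.ofReal (p ω)) = ∫ ω, p ω * h ω ∂lam := by
  rw [integral_withDensity_eq_integral_toReal_smul hp.ennreal_ofReal
    (.of_forall fun _ => ENNReal.ofReal_lt_top)]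
  simp only [ENNReal.toReal_ofReal (hp0 _), smul_eq_mul]

/-- For probability measures with densities `p` and `q`, the `H`–`W1` distance is the integral of
the positive part of `q - p`. -/
theorem dHW1_withDensity_eq_integral_max {Ω : Type*} [MeasurableSpace Ω]
    {lam : Measure Ω} {p q : Ω → ℝ} (hp : Measurable p) (hq : Measurable q)
    (hp0 : ∀ ω, 0 ≤ p ω) (hq0 : ∀ ω, 0 ≤ q ω)
    (hμ : IsProbabilityMeasure (lam.withDensity fun ω => ENNReal.ofReal (p ω)))
    (hν : IsProbabilityMeasure (lam.withDensity fun ω => ENNReal.ofReal (q ω))) :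
    dHW1 (lam.withDensity fun ω => ENNReal.ofReal (p ω))
      (lam.withDensity fun ω => ENNReal.ofReal (q ω)) = ∫ ω, max (q ω - p ω) 0 ∂lam := by
  have ip : Integrable p lam :=
    integrable_of_isFiniteMeasure_withDensity_ofReal hp hp0 inferInstance
  have iq : Integrable q lam :=
    integrable_of_isFiniteMeasure_withDensity_ofReal hq hq0 inferInstance
  have int_p : ∫ ω, p ω ∂lam = 1 := by
    simpa using (integral_withDensity_ofReal (lam := lam) hp hp0 fun _ => 1).symm
  have int_q : ∫ ω, q ω ∂lam = 1 := by
    simpa using (integral_withDensity_ofReal (lam := lam) hq hq0 fun _ => 1).symm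
  have imul : ∀ {f h : Ω → ℝ}, Integrable f lam → Measurable h → (∀ ω, 0 ≤ h ω) →
      (∀ ω, h ω ≤ 1) → Integrable (fun ω => f ω * h ω) lam := fun hf hm h0 h1 =>
    hf.mul_bdd (c := 1) hm.aestronglyMeasurable
      (.of_forall fun ω => by rw [Real.norm_of_nonneg (h0 ω)]; exact h1 ω)
  have key : ∀ h : Ω → ℝ, Measurable h → (∀ ω, 0 ≤ h ω) → (∀ ω, h ω ≤ 1) →
      Integrable (fun ω => (q ω - p ω) * (1 - h ω)) lam ∧
      ∫ ω, p ω * h ω ∂lam - ∫ ω, q ω * h ω ∂lam = ∫ ω, (q ω - p ω) * (1 - h ω) ∂lam := by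
    intro h hm h0 h1
    have iph := imul ip hm h0 h1
    have iqh := imul iq hm h0 h1
    have e : (fun ω => (q ω - p ω) * (1 - h ω)) =
        fun ω => (q ω - p ω) + (p ω * h ω - q ω * h ω) := by
      funext ω; ring
    rw [e]
    have iqp : Integrable (fun ω => q ω - p ω) lam := iq.sub ip
    have ipqh : Integrable (fun ω => p ω * h ω - q ω * h ω) lam := iph.sub iqh
    refine ⟨iqp.add ipqh, ?_⟩
    rw [integral_add iqp ipqh, integral_sub iq ip, integral_sub iph iqh,
      int_p, int_q]
    ring
  refine IsGreatest.csSup_eq ⟨?_, ?_⟩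
  · have hA : MeasurableSet {ω | q ω ≤ p ω} := measurableSet_le hq hp
    have hm : Measurable ({ω | q ω ≤ p ω}.indicator fun _ => (1 : ℝ)) :=
      measurable_const.indicator hA
    have h0 : ∀ ω, 0 ≤ {ω | q ω ≤ p ω}.indicator (fun _ => (1 : ℝ)) ω :=
      Set.indicator_nonneg fun _ _ => zero_le_one
    have h1 : ∀ ω, {ω | q ω ≤ p ω}.indicator (fun _ => (1 : ℝ)) ω ≤ 1 :=
      Set.indicator_le_self' fun _ _ => zero_le_one
    refine ⟨_, hm, h0, h1, ?_⟩
    rw [integral_withDensity_ofReal hp hp0, integral_withDensity_ofReal hq hq0,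
      (key _ hm h0 h1).2]
    refine integral_congr_ae (.of_forall fun ω => ?_)
    by_cases hω : q ω ≤ p ω
    · simp [hω]
    · simp [hω, (not_le.mp hω).le]
  · rintro _ ⟨h, hm, h0, h1, rfl⟩
    rw [integral_withDensity_ofReal hp hp0, integral_withDensity_ofReal hq hq0,
      (key h hm h0 h1).2]
    refine integral_mono (key h hm h0 h1).1 (iq.sub ip).pos_part fun ω => ?_
    calc (q ω - p ω) * (1 - h ω) ≤ max (q ω - p ω) 0 * (1 - h ω) :=
          mul_le_mul_of_nonneg_right (le_max_left _ _) (sub_nonneg.mpr (h1 ω))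
      _ ≤ max (q ω - p ω) 0 :=
          mul_le_of_le_one_right (le_max_right _ _) (sub_le_self _ (h0 ω))

/-- (Lemma 1.) With `μ` (primary) and `ν` (backdoor) probability measures with densities
`p` and `q` w.r.t. a σ-finite `lam`, `q = p / Z` a.e. off the measurable set `S` for some
`Z ≥ 1`, and positive reals `b, κ, β` with `μ(S) = b/κ > 0` and `ν(S) = β·b/Z > 0`, we have
`d_{H−W1}(μ, ν) = b · ∫_S max((β/Z)·q/ν(S) − (1/κ)·p/μ(S), 0) dlam`. -/
theorem dHW1_eq_b_mul_setIntegral {Ω : Type*} [MeasurableSpace Ω]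
    (lam : Measure Ω) [SigmaFinite lam]
    (p q : Ω → ℝ) (hp : Measurable p) (hq : Measurable q)
    (hp0 : ∀ ω, 0 ≤ p ω) (hq0 : ∀ ω, 0 ≤ q ω)
    (μ ν : Measure Ω) [IsProbabilityMeasure μ] [IsProbabilityMeasure ν]
    (hμ : μ = lam.withDensity fun ω => ENNReal.ofReal (p ω))
    (hν : ν = lam.withDensity fun ω => ENNReal.ofReal (q ω))
    (S : Set Ω) (hS : MeasurableSet S)
    (Z : ℝ) (hZ : 1 ≤ Z)
    (hoff : ∀ᵐ ω ∂lam, ω ∉ S → q ω = p ω / Z)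
    (b κ β : ℝ) (hb : 0 < b) (hκ : 0 < κ) (hβ : 0 < β)
    (hμS : (μ S).toReal = b / κ) (hμSpos : 0 < (μ S).toReal)
    (hνS : (ν S).toReal = β * b / Z) (hνSpos : 0 < (ν S).toReal) :
    dHW1 μ ν =
      b * ∫ ω in S,
        max ((β / Z) * q ω / (ν S).toReal - (1 / κ) * p ω / (μ S).toReal) 0 ∂lam := by
  have hZ0 : 0 < Z := one_pos.trans_le hZ
  rw [hμS, hνS]
  subst hμ hν
  rw [dHW1_withDensity_eq_integral_max hp hq hp0 hq0 ‹_› ‹_›, ← integral_const_mul]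
  have hzero : ∀ᵐ ω ∂lam, ω ∉ S → max (q ω - p ω) 0 = 0 := by
    filter_upwards [hoff] with ω h hω
    rw [h hω]
    exact max_eq_right (sub_nonpos.mpr (div_le_self (hp0 ω) hZ))
  rw [← setIntegral_eq_integral_of_ae_compl_eq_zero hzero]
  refine integral_congr_ae (.of_forall fun ω => ?_)
  simp only
  rw [mul_max_of_nonneg _ _ hb.le, mul_zero]
  congr 1
  field_simp
end

section
/- (Lemma 2, prediction difference) Let μ and ν be probability measures on a measurable space Ω, and let S ⊆ Ω be a measurable set with μ(S) = ν(S) > 0. Then for every measurable h : Ω → ℝ with 0 ≤ h ≤ 1: (1/ν(S)) · ∫_S h dν − (1/μ(S)) · ∫_S h dμ ≤ d_{H−W1}(μ, ν) / μ(S). In particular, in the backdoor setting with β = 1/κ, where μ(S) = Pr(B)/κ and d_{H−W1}(μ, ν) = α · Pr(B), the difference of conditional expectations of h given S under ν and under μ is at most α·κ. -/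
open MeasureTheory

theorem sub_integral_le_dHW1 {Ω : Type*} [MeasurableSpace Ω]
    (μ ν : Measure Ω) [IsProbabilityMeasure μ] [IsProbabilityMeasure ν]
    {h : Ω → ℝ} (hm : Measurable h) (h0 : ∀ ω, 0 ≤ h ω) (h1 : ∀ ω, h ω ≤ 1) :
    ∫ ω, h ω ∂μ - ∫ ω, h ω ∂ν ≤ dHW1 μ ν := by
  refine le_csSup ⟨1, ?_⟩ ⟨h, hm, h0, h1, rfl⟩
  rintro _ ⟨g, hg, g0, g1, rfl⟩
  have hν : 0 ≤ ∫ ω, g ω ∂ν := integral_nonneg g0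
  have hμ : ∫ ω, g ω ∂μ ≤ 1 := by
    simpa using integral_mono_of_nonneg (μ := μ) (.of_forall g0) (integrable_const (1 : ℝ))
      (.of_forall g1)
  linarith

/-- (Lemma 2, prediction difference.) For probability measures `μ`, `ν` and a measurable
set `S` with `μ(S) = ν(S) > 0`, for every measurable `h : Ω → ℝ` with `0 ≤ h ≤ 1`, the
difference of the conditional expectations of `h` given `S` under `ν` and under `μ` is
at most `d_{H−W1}(μ, ν) / μ(S)`. -/
theorem prediction_difference {Ω : Type*} [MeasurableSpace Ω]
    (μ ν : Measure Ω) [IsProbabilityMeasure μ] [IsProbabilityMeasure ν]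
    (S : Set Ω) (hS : MeasurableSet S) (hμν : μ S = ν S) (hpos : 0 < μ S) :
    ∀ h : Ω → ℝ, Measurable h → (∀ ω, 0 ≤ h ω) → (∀ ω, h ω ≤ 1) →
      (1 / (ν S).toReal) * ∫ ω in S, h ω ∂ν - (1 / (μ S).toReal) * ∫ ω in S, h ω ∂μ
        ≤ dHW1 μ ν / (μ S).toReal := by
  intro h hm h0 h1
  have hi : ∀ ρ : Measure Ω, IsProbabilityMeasure ρ →
      ∫ ω, (1 - S.indicator h ω) ∂ρ = 1 - ∫ ω in S, h ω ∂ρ := fun ρ _ ↦ by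
    have hint : Integrable h ρ := .of_bound hm.aestronglyMeasurable 1 <|
      .of_forall fun ω ↦ by simpa [abs_of_nonneg (h0 ω)] using h1 ω
    rw [integral_sub (integrable_const 1) (hint.indicator hS), integral_indicator hS]
    simp
  have key := sub_integral_le_dHW1 μ ν (h := fun ω ↦ 1 - S.indicator h ω)
    (measurable_const.sub (hm.indicator hS))
    (fun ω ↦ sub_nonneg.2 (Set.indicator_le' (fun ω _ ↦ h1 ω) (fun _ _ ↦ zero_le_one) ω))
    (fun ω ↦ sub_le_self 1 (Set.indicator_nonneg (fun ω _ ↦ h0 ω) ω))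
  rw [hi μ inferInstance, hi ν inferInstance] at key
  rw [← hμν, ← mul_sub, one_div_mul_eq_div]
  gcongr
  linarith
end
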